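/- arXiv:1906.04502 — 2 statements merged into one kernel-verified Lean document; each statement's English description precedes it below -/
import Mathlib

section
/- Let γ = 0 and R_SSM(α) = α·α(α(2α-5) + 4)/((α-1)α² + 1). For every α with 0 < α ≤ 1/2, R_SSM(α) > α if and only if α > (3 - √5)/2. In particular, at γ = 0 semi-selfish mining becomes profitable exactly at the threshold (3-√5)/2 ≈ 0.38. -/
/-- Relative revenue of a single SSM miner with hash power α at propagation γ = 0. -/
noncomputable def R_SSM (α : ℝ) : ℝ :=
  α * (α * (α * (2 * α - 5) + 4)) / ((α - 1) * α ^ 2 + 1)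

theorem ssm_threshold_gamma_zero (α : ℝ) (hα0 : 0 < α) (hα : α ≤ 1 / 2) :
    R_SSM α > α ↔ α > (3 - Real.sqrt 5) / 2 := by
  have h_den : 0 < (α - 1) * α ^ 2 + 1 := by nlinarith [sq_nonneg α, pow_pos hα0 3]
  have h_sq : Real.sqrt 5 ^ 2 = 5 := Real.sq_sqrt (by norm_num)
  have h_nonneg : 0 ≤ Real.sqrt 5 := Real.sqrt_nonneg 5
  have h_factor : α * (α * (α * (2 * α - 5) + 4)) - α * ((α - 1) * α ^ 2 + 1) =
      α * (1 - α) * ((3 + Real.sqrt 5) / 2 - α) * (α - (3 - Real.sqrt 5) / 2) := by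
    linear_combination (-(α * (1 - α)) / 4) * h_sq
  have h_pos : 0 < α * (1 - α) * ((3 + Real.sqrt 5) / 2 - α) :=
    mul_pos (mul_pos hα0 (by linarith)) (by linarith)
  rw [R_SSM, gt_iff_lt, lt_div_iff₀ h_den, ← sub_pos, h_factor, mul_pos_iff_of_pos_left h_pos,
    sub_pos]
end

section
/- Let γ = 0 and R_SM(α) = (α(1-α)²·4α - α³)/(1 - α(1 + (2-α)α)). For every α with 0 < α ≤ 1/2, R_SM(α) > α if and only if α > 1/3. In particular, at γ = 0 selfish mining becomes profitable exactly at the threshold 1/3. -/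
/-- Eyal–Sirer relative revenue of a single selfish miner with hash power α at
propagation γ = 0. -/
noncomputable def R_SM (α : ℝ) : ℝ :=
  (α * (1 - α) ^ 2 * (4 * α) - α ^ 3) / (1 - α * (1 + (2 - α) * α))

theorem sm_threshold_gamma_zero (α : ℝ) (hα0 : 0 < α) (hα : α ≤ 1 / 2) :
    R_SM α > α ↔ α > 1 / 3 := by
  have hden : 0 < 1 - α * (1 + (2 - α) * α) := by
    nlinarith [mul_nonneg hα0.le (sub_nonneg.2 hα), pow_pos hα0 3]
  have hfactor : α * (1 - α) ^ 2 * (4 * α) - α ^ 3 - α * (1 - α * (1 + (2 - α) * α)) =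
      α * (1 - α) ^ 2 * (3 * α - 1) := by ring
  have hpos : 0 < α * (1 - α) ^ 2 := mul_pos hα0 (pow_pos (by linarith) 2)
  rw [R_SM, gt_iff_lt, lt_div_iff₀ hden, ← sub_pos, hfactor, mul_pos_iff_of_pos_left hpos]
  constructor <;> intro h <;> linarith
end
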